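/- Let P be an n-Vee with P⁺ = P ∪ {∞}, K a field, let I and M be convex representations of P, and let Λ be a translation on P⁺. Suppose there exists a nonzero morphism of representations from I to M, and suppose there exists t with Λt ∈ Supp(I) ∩ Supp(M). Then there exists a nonzero morphism of representations from IΛ to MΛ. -/

import Mathlib

namespace GPM

/-- A translation on a preorder: a monotone map `Λ` with `x ≤ Λ x` for all `x`. -/
structure Translation (Q : Type*) [Preorder Q] where
  toFun : Q → Q
  mono : Monotone toFun
  le_apply : ∀ x, x ≤ toFun x

/-- A subset `S` is connected if any two of its elements can be joined by a finite
sequence of elements of `S` in which consecutive elements are comparable. -/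
def ConnectedIn {Q : Type*} [Preorder Q] (S : Set Q) : Prop :=
  ∀ x ∈ S, ∀ y ∈ S,
    Relation.ReflTransGen (fun a b => a ∈ S ∧ b ∈ S ∧ (a ≤ b ∨ b ≤ a)) x y

/-- `P` is an n-Vee with (unique) minimal element `m`: `m` is the unique minimal element,
the interval `[m, M]` is totally ordered for every maximal element `M`, and
`[m, M] ∩ [m, M'] = {m}` for distinct maximal elements `M, M'`. -/
structure IsNVee (P : Type*) [PartialOrder P] (m : P) : Prop where
  isMin : IsMin m
  eq_of_isMin : ∀ p : P, IsMin p → p = m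
  icc_chain : ∀ M : P, IsMax M → ∀ x ∈ Set.Icc m M, ∀ y ∈ Set.Icc m M, x ≤ y ∨ y ≤ x
  icc_inter : ∀ M M' : P, IsMax M → IsMax M' → M ≠ M' →
      Set.Icc m M ∩ Set.Icc m M' = {m}

/-- A representation of a poset `P` with values in `K`-vector spaces. -/
structure Rep (P : Type*) [Preorder P] (K : Type*) [Field K] where
  V : P → Type*
  [addCommGroup : ∀ p, AddCommGroup (V p)]
  [module : ∀ p, Module K (V p)]
  map : ∀ {p q : P}, p ≤ q → V p →ₗ[K] V q
  map_refl : ∀ p : P, map (le_refl p) = LinearMap.id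
  map_comp : ∀ {p q r : P} (hpq : p ≤ q) (hqr : q ≤ r),
      (map hqr).comp (map hpq) = map (hpq.trans hqr)

attribute [instance] Rep.addCommGroup Rep.module

/-- A morphism of representations (a natural transformation). -/
structure RepHom {P : Type*} [Preorder P] {K : Type*} [Field K] (M N : Rep P K) where
  app : ∀ p, M.V p →ₗ[K] N.V p
  natural : ∀ {p q : P} (h : p ≤ q), (N.map h).comp (app p) = (app q).comp (M.map h)

/-- The shift `MΛ : p ↦ M(Λ p)` of a representation by a translation. -/
def Rep.shift {P : Type*} [Preorder P] {K : Type*} [Field K]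
    (M : Rep P K) (Λ : Translation P) : Rep P K where
  V p := M.V (Λ.toFun p)
  map h := M.map (Λ.mono h)
  map_refl p := M.map_refl (Λ.toFun p)
  map_comp h1 h2 := M.map_comp (Λ.mono h1) (Λ.mono h2)

/-- The submodule of `K` underlying the convex representation of `S` at the point `p`:
all of `K` on `S`, and `0` off `S`. -/
noncomputable def convexSub (K : Type*) [Field K] {Q : Type*} (S : Set Q) (p : Q) :
    Submodule K K :=
  @ite _ (p ∈ S) (Classical.dec _) ⊤ ⊥

theorem convexSub_pos (K : Type*) [Field K] {Q : Type*} {S : Set Q} {p : Q} (h : p ∈ S) :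
    convexSub K S p = ⊤ := by
  rw [convexSub, if_pos h]

theorem convexSub_neg (K : Type*) [Field K] {Q : Type*} {S : Set Q} {p : Q} (h : p ∉ S) :
    convexSub K S p = ⊥ := by
  rw [convexSub, if_neg h]

/-- The canonical map between the fibers of the convex representations of `S` and `T`:
the identity of `K` when both fibers are `K`, and zero otherwise. -/
noncomputable def phiMap (K : Type*) [Field K] {Q : Type*} (S T : Set Q) (p q : Q) :
    ↥(convexSub K S p) →ₗ[K] ↥(convexSub K T q) :=
  @dite _ (p ∈ S ∧ q ∈ T) (Classical.dec _)
    (fun h => Submodule.inclusion (le_of_eq (by rw [convexSub_pos K h.1, convexSub_pos K h.2])))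
    (fun _ => 0)

theorem phiMap_neg (K : Type*) [Field K] {Q : Type*} {S T : Set Q} {p q : Q}
    (h : ¬(p ∈ S ∧ q ∈ T)) : phiMap K S T p q = 0 := by
  rw [phiMap, dif_neg h]

/-- The convex representation with support the interval-convex set `S`:
`K` at points of `S`, `0` elsewhere, with identity structure maps inside `S`. -/
noncomputable def convexRep (K : Type*) [Field K] {Q : Type*} [Preorder Q]
    (S : Set Q) (hS : S.OrdConnected) : Rep Q K where
  V p := ↥(convexSub K S p)
  map {p q} _ := phiMap K S S p q
  map_refl p := by
    show phiMap K S S p p = LinearMap.id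
    by_cases hp : p ∈ S
    · rw [phiMap, dif_pos ⟨hp, hp⟩]
      rfl
    · rw [phiMap_neg (K := K) (by tauto)]
      apply LinearMap.ext
      intro x
      have hx : x = 0 := by
        apply Subtype.ext
        have hle : convexSub K S p ≤ ⊥ := le_of_eq (convexSub_neg K hp)
        simpa using hle x.2
      simp [hx]
  map_comp {p q r} hpq hqr := by
    show (phiMap K S S q r).comp (phiMap K S S p q) = phiMap K S S p r
    by_cases hp : p ∈ S
    · by_cases hr : r ∈ S
      · have hq : q ∈ S := hS.out hp hr ⟨hpq, hqr⟩
        rw [phiMap, phiMap, phiMap, dif_pos ⟨hq, hr⟩, dif_pos ⟨hp, hq⟩, dif_pos ⟨hp, hr⟩]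
        rfl
      · rw [phiMap_neg (K := K) (S := S) (T := S) (p := q) (q := r) (by tauto),
          phiMap_neg (K := K) (S := S) (T := S) (p := p) (q := r) (by tauto)]
        simp
    · rw [phiMap_neg (K := K) (S := S) (T := S) (p := p) (q := q) (by tauto),
        phiMap_neg (K := K) (S := S) (T := S) (p := p) (q := r) (by tauto)]
      simp

theorem IsNVee.le {P : Type*} [PartialOrder P] [Finite P] {m : P} (hP : IsNVee P m) (x : P) :
    m ≤ x := by
  obtain ⟨b, hbx, hb⟩ := Set.finite_univ.exists_le_minimal (Set.mem_univ x)
  exact hP.eq_of_isMin b (fun c hc => hb.2 (Set.mem_univ c) hc) ▸ hbx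

theorem exists_isMax_ge {P : Type*} [PartialOrder P] [Finite P] (x : P) :
    ∃ M, x ≤ M ∧ IsMax M := by
  obtain ⟨b, hxb, hb⟩ := Set.finite_univ.exists_le_maximal (Set.mem_univ x)
  exact ⟨b, hxb, fun c hc => hb.2 (Set.mem_univ c) hc⟩

/-- Comparability is transitive through any element other than the minimal one. -/
theorem IsNVee.comparable_trans {P : Type*} [PartialOrder P] [Finite P] {m : P}
    (hP : IsNVee P m) {x y z : P} (hy : y ≠ m) (hxy : x ≤ y ∨ y ≤ x) (hyz : y ≤ z ∨ z ≤ y) :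
    x ≤ z ∨ z ≤ x := by
  rcases hxy with hxy | hyx
  · rcases hyz with hyz | hzy
    · exact Or.inl (hxy.trans hyz)
    · obtain ⟨M, hyM, hM⟩ := exists_isMax_ge y
      exact hP.icc_chain M hM x ⟨hP.le x, hxy.trans hyM⟩ z ⟨hP.le z, hzy.trans hyM⟩
  · rcases hyz with hyz | hzy
    · obtain ⟨M, hxM, hM⟩ := exists_isMax_ge x
      obtain ⟨M', hzM, hM'⟩ := exists_isMax_ge z
      obtain rfl : M = M' := by
        by_contra hne
        have hmem : y ∈ Set.Icc m M ∩ Set.Icc m M' :=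
          ⟨⟨hP.le y, hyx.trans hxM⟩, ⟨hP.le y, hyz.trans hzM⟩⟩
        rw [hP.icc_inter M M' hM hM' hne] at hmem
        exact hy hmem
      exact hP.icc_chain M hM x ⟨hP.le x, hxM⟩ z ⟨hP.le z, hzM⟩
    · exact Or.inr (hzy.trans hyx)

/-- A connected subset of an n-Vee avoiding the minimal element is a chain. -/
theorem IsNVee.comparable_of_connectedIn {P : Type*} [PartialOrder P] [Finite P] {m : P}
    (hP : IsNVee P m) {S : Set (WithTop P)} (hS : ConnectedIn S) (htop : (⊤ : WithTop P) ∉ S)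
    (hm : (m : WithTop P) ∉ S) {x y : WithTop P} (hx : x ∈ S) (hy : y ∈ S) :
    x ≤ y ∨ y ≤ x := by
  have hcoe : ∀ z ∈ S, ∃ a : P, (a : WithTop P) = z := fun z hz =>
    WithTop.ne_top_iff_exists.mp fun h => htop (h ▸ hz)
  have hpath := hS x hx y hy
  clear hy
  induction hpath with
  | refl => exact Or.inl le_rfl
  | tail _ hstep ih =>
    obtain ⟨hb, hc, hbc⟩ := hstep
    obtain ⟨a, rfl⟩ := hcoe _ hx
    obtain ⟨b, rfl⟩ := hcoe _ hb
    obtain ⟨c, rfl⟩ := hcoe _ hc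
    simp only [WithTop.coe_le_coe] at ih hbc ⊢
    exact hP.comparable_trans (fun h => hm (h ▸ hb)) ih hbc

theorem phiMap_bijective (K : Type*) [Field K] {Q : Type*} {S T : Set Q} {p q : Q}
    (hp : p ∈ S) (hq : q ∈ T) : Function.Bijective (phiMap K S T p q) := by
  rw [phiMap, dif_pos ⟨hp, hq⟩]
  refine ⟨Submodule.inclusion_injective _, fun y => ⟨⟨y, ?_⟩, rfl⟩⟩
  rw [convexSub_pos K hp]
  trivial

theorem subsingleton_convexSub (K : Type*) [Field K] {Q : Type*} {S : Set Q} {p : Q}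
    (hp : p ∉ S) : Subsingleton (convexSub K S p) := by
  rw [convexSub_neg K hp]
  infer_instance

/-- The points of the common support at which a morphism of convex representations is nonzero
form a union of connected components. -/
theorem RepHom.app_eq_zero_iff_of_le {Q : Type*} [Preorder Q] {K : Type*} [Field K]
    {S T : Set Q} {hS : S.OrdConnected} {hT : T.OrdConnected}
    (f : RepHom (convexRep K S hS) (convexRep K T hT)) {p q : Q} (hpq : p ≤ q)
    (hp : p ∈ S ∩ T) (hq : q ∈ S ∩ T) : f.app p = 0 ↔ f.app q = 0 := by
  have hnat : ∀ v, phiMap K T T p q (f.app p v) = f.app q (phiMap K S S p q v) :=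
    fun v => LinearMap.congr_fun (f.natural hpq) v
  constructor
  · intro h
    refine LinearMap.ext fun w => ?_
    obtain ⟨v, rfl⟩ := (phiMap_bijective K hp.1 hq.1).2 w
    refine (hnat v).symm.trans ?_
    rw [h]
    exact map_zero (phiMap K T T p q)
  · intro h
    refine LinearMap.ext fun v => (phiMap_bijective K hp.2 hq.2).1 ?_
    refine (hnat v).trans ?_
    rw [h]
    exact (map_zero (phiMap K T T p q)).symm

theorem RepHom.mem_of_app_ne_zero {Q : Type*} [Preorder Q] {K : Type*} [Field K]
    {S T : Set Q} {hS : S.OrdConnected} {hT : T.OrdConnected}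
    (f : RepHom (convexRep K S hS) (convexRep K T hT)) {p : Q} (hp : f.app p ≠ 0) :
    p ∈ S ∩ T := by
  constructor
  · by_contra h
    refine hp (LinearMap.ext fun v => ?_)
    have hv : v = 0 := (subsingleton_convexSub K h).elim _ _
    rw [hv, map_zero, map_zero]
  · by_contra h
    exact hp (LinearMap.ext fun v => (subsingleton_convexSub K h).elim _ _)

/-- Precomposition of a morphism with a translation. -/
def RepHom.shift {Q : Type*} [Preorder Q] {K : Type*} [Field K] {M N : Rep Q K}
    (f : RepHom M N) (Λ : Translation Q) : RepHom (M.shift Λ) (N.shift Λ) where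
  app p := f.app (Λ.toFun p)
  natural h := f.natural (Λ.mono h)

/-- Let `P` be an n-Vee, `I`, `M` convex representations of `P`
(viewed as representations of `P⁺` vanishing at `∞`) with supports `S`, `T`, and `Λ` a
translation on `P⁺`.  If there is a nonzero morphism `I → M` and some `t` with
`Λ t ∈ S ∩ T`, then there is a nonzero morphism `IΛ → MΛ`. -/
theorem statement9 {P : Type*} [PartialOrder P] [Finite P] (m : P) (hP : IsNVee P m)
    {K : Type*} [Field K]
    (S T : Set (WithTop P))
    (hSne : S.Nonempty) (hSconn : ConnectedIn S) (hSconv : S.OrdConnected)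
    (hStop : (⊤ : WithTop P) ∉ S)
    (hTne : T.Nonempty) (hTconn : ConnectedIn T) (hTconv : T.OrdConnected)
    (hTtop : (⊤ : WithTop P) ∉ T)
    (Λ : Translation (WithTop P))
    (hhom : ∃ f : RepHom (convexRep K S hSconv) (convexRep K T hTconv),
        ∃ p, f.app p ≠ 0)
    (ht : ∃ t : WithTop P, Λ.toFun t ∈ S ∩ T) :
    ∃ g : RepHom ((convexRep K S hSconv).shift Λ) ((convexRep K T hTconv).shift Λ),
      ∃ p, g.app p ≠ 0 := by
  obtain ⟨f, p, hp⟩ := hhom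
  obtain ⟨t, ht⟩ := ht
  refine ⟨f.shift Λ, t, ?_⟩
  change f.app (Λ.toFun t) ≠ 0
  generalize Λ.toFun t = q at ht
  have hpST := f.mem_of_app_ne_zero hp
  by_cases hcomp : p ≤ q ∨ q ≤ p
  · rcases hcomp with h | h
    · exact (f.app_eq_zero_iff_of_le h hpST ht).not.mp hp
    · exact (f.app_eq_zero_iff_of_le h ht hpST).not.mpr hp
  · have hm : (m : WithTop P) ∈ S ∩ T := by
      constructor
      · by_contra hm
        exact hcomp (hP.comparable_of_connectedIn hSconn hStop hm hpST.1 ht.1)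
      · by_contra hm
        exact hcomp (hP.comparable_of_connectedIn hTconn hTtop hm hpST.2 ht.2)
    have hle : ∀ x : WithTop P, (m : WithTop P) ≤ x := fun x => by
      cases x with
      | top => exact le_top
      | coe a => exact WithTop.coe_le_coe.mpr (hP.le a)
    exact (f.app_eq_zero_iff_of_le (hle q) hm ht).not.mp
      ((f.app_eq_zero_iff_of_le (hle p) hm hpST).not.mpr hp)

end GPM
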